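/- Let ρ be a real number with 2/3 < ρ < 1 and let K > 0. Then there exist constants C > 0 and ε₀ ∈ (0, 1) such that for every ε ∈ (0, ε₀), every x ∈ ℝ², every continuous O : ℝ → ℝ², and every t ≥ ε^ρ: (1/ε²) · ∫₀^{K ε^{2ρ}} ( ∫_{B(O(s), ε^ρ)} exp(−‖x−y‖²/(t−s)) dy ) / (t−s) ds ≤ C · ε^{3ρ−2}, where B(z, r) denotes the open Euclidean ball of center z and radius r in ℝ² and the integrals are Lebesgue integrals. -/

import Mathlib

open MeasureTheory

/-- The integral of a Gaussian over a disc is at most the area of the disc. -/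
theorem norm_setIntegral_ball_exp_neg_le (x z : EuclideanSpace ℝ (Fin 2)) {r τ : ℝ}
    (hr : 0 ≤ r) (hτ : 0 ≤ τ) :
    ‖∫ y in Metric.ball z r, Real.exp (-‖x - y‖ ^ 2 / τ)‖ ≤ Real.pi * r ^ 2 := by
  have hvol : volume.real (Metric.ball z r) = Real.pi * r ^ 2 := by
    rw [Measure.real, EuclideanSpace.volume_ball_fin_two, ENNReal.toReal_mul,
      ENNReal.toReal_pow, ENNReal.toReal_ofReal hr, ENNReal.toReal_ofReal Real.pi_nonneg,
      mul_comm]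
  have h := norm_setIntegral_le_of_norm_le_const (μ := volume) (C := 1)
    (f := fun y => Real.exp (-‖x - y‖ ^ 2 / τ)) (measure_ball_lt_top (x := z) (r := r))
    (fun y _ => by
      rw [Real.norm_eq_abs, Real.abs_exp, Real.exp_le_one_iff, neg_div]
      exact neg_nonpos.mpr (by positivity))
  rwa [one_mul, hvol] at h

/-- Over times `s ≤ a ≤ t / 2`, the Gaussian mass of a moving disc of radius `r`, weighted by
`1 / (t - s)`, is at most `2 π r² a / t`. -/
theorem intervalIntegral_setIntegral_ball_exp_neg_div_le (x : EuclideanSpace ℝ (Fin 2))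
    (O : ℝ → EuclideanSpace ℝ (Fin 2)) {r a t : ℝ} (hr : 0 ≤ r) (ha : 0 ≤ a) (ht : 0 < t)
    (hat : a ≤ t / 2) :
    ∫ s in (0:ℝ)..a, (∫ y in Metric.ball (O s) r, Real.exp (-‖x - y‖ ^ 2 / (t - s))) / (t - s)
      ≤ Real.pi * r ^ 2 / (t / 2) * a := by
  refine (le_abs_self _).trans ?_
  have h := intervalIntegral.norm_integral_le_of_norm_le_const (a := 0) (b := a)
    (C := Real.pi * r ^ 2 / (t / 2))
    (f := fun s => (∫ y in Metric.ball (O s) r, Real.exp (-‖x - y‖ ^ 2 / (t - s))) / (t - s))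
    (fun s hs => by
      rw [Set.uIoc_of_le ha] at hs
      have hts : t / 2 ≤ t - s := by linarith [hs.2]
      have hpos : 0 < t - s := by linarith
      rw [norm_div, Real.norm_of_nonneg hpos.le]
      have := norm_setIntegral_ball_exp_neg_le x (O s) hr hpos.le
      gcongr)
  rwa [sub_zero, abs_of_nonneg ha] at h

/-- Estimate for the contribution of times `s ≤ K ε^{2ρ}` at observation times
`t ≥ ε^ρ`: the (1/ε²)-weighted Gaussian integral over the moving balls of
radius `ε^ρ` is bounded by `C ε^{3ρ-2}`. -/
theorem stmt_11 (ρ K : ℝ) (hρ : 2 / 3 < ρ) (hρ1 : ρ < 1) (hK : 0 < K) :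
    ∃ C > (0:ℝ), ∃ ε₀ ∈ Set.Ioo (0:ℝ) 1, ∀ ε ∈ Set.Ioo (0:ℝ) ε₀,
      ∀ x : EuclideanSpace ℝ (Fin 2),
      ∀ O : ℝ → EuclideanSpace ℝ (Fin 2), Continuous O →
      ∀ t : ℝ, ε ^ ρ ≤ t →
        (1 / ε ^ 2) *
          (∫ s in (0:ℝ)..(K * ε ^ (2 * ρ)),
            (∫ y in Metric.ball (O s) (ε ^ ρ),
              Real.exp (-‖x - y‖ ^ 2 / (t - s))) / (t - s))
          ≤ C * ε ^ (3 * ρ - 2) := by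
  have hρ0 : 0 < ρ := by linarith
  refine ⟨2 * Real.pi * K, by positivity, min (1 / 2) ((1 / (2 * K)) ^ (1 / ρ)),
    ⟨by positivity, (min_le_left _ _).trans_lt (by norm_num)⟩, ?_⟩
  rintro ε ⟨hε, hε₀⟩ x O - t ht
  have hr : 0 < ε ^ ρ := by positivity
  have hKr : K * ε ^ ρ ≤ 1 / 2 := by
    have h : ε ^ ρ ≤ 1 / (2 * K) := by
      calc ε ^ ρ ≤ ((1 / (2 * K)) ^ (1 / ρ)) ^ ρ := by
            gcongr
            exact hε₀.le.trans (min_le_right _ _)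
        _ = 1 / (2 * K) := by
            rw [← Real.rpow_mul (by positivity), one_div_mul_cancel hρ0.ne', Real.rpow_one]
    calc K * ε ^ ρ ≤ K * (1 / (2 * K)) := by gcongr
      _ = 1 / 2 := by field_simp
  have hsq : ε ^ (2 * ρ) = (ε ^ ρ) ^ 2 := by
    rw [mul_comm, Real.rpow_mul hε.le, Real.rpow_two]
  have hcube : ε ^ (3 * ρ - 2) = (ε ^ ρ) ^ 3 / ε ^ 2 := by
    rw [Real.rpow_sub hε, Real.rpow_two, mul_comm, Real.rpow_mul hε.le]
    norm_cast
  rw [hsq, hcube]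
  generalize ε ^ ρ = r at *
  have hat : K * r ^ 2 ≤ t / 2 := by nlinarith
  calc _ ≤ 1 / ε ^ 2 * (Real.pi * r ^ 2 / (t / 2) * (K * r ^ 2)) := by
        gcongr
        exact intervalIntegral_setIntegral_ball_exp_neg_div_le x O hr.le (by positivity)
          (hr.trans_le ht) hat
    _ ≤ 1 / ε ^ 2 * (Real.pi * r ^ 2 / (r / 2) * (K * r ^ 2)) := by gcongr
    _ = 2 * Real.pi * K * (r ^ 3 / ε ^ 2) := by field_simp
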